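/- Let m be a positive integer divisible by 2⁶ and let a be any integer. Then for each sign ± and all X ≥ 1, the number of isomorphism classes of quadratic fields F with 0 < ±Disc(F) < X and Disc(F) ≡ a (mod m) equals (8/(π²·m))·e(a,2)·Π_{p odd prime, p^k ∥ m, k ≥ 1} e(a, p^k)·(1 − p⁻²)⁻¹·X + O(X^{1/2}), where the implied constant is absolute (independent of m, a, X). -/

import Mathlib

open scoped Classical
noncomputable section

/-- Discriminant of a subfield of `ℂ` (as a number field); junk value `0` if the
subfield is not finite-dimensional over `ℚ`. -/
noncomputable def subDisc (K : Subfield ℂ) : ℤ :=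
  if h : FiniteDimensional ℚ K then
    letI := h
    haveI : NumberField K := ⟨⟩
    NumberField.discr K
  else 0

/-- The number of isomorphism classes of number fields (as subfields of `ℂ`)
satisfying a predicate `P`. -/
noncomputable def countFields (P : Subfield ℂ → Prop) : ℕ :=
  Nat.card (Quot (fun K L : {K : Subfield ℂ // P K} => Nonempty (K.1 ≃+* L.1)))

/-- The local factor `e(a, p^k)` at an odd prime `p` with `p^k ∥ m`. -/
noncomputable def eOdd (a : ℤ) (p k : ℕ) : ℝ :=
  if ¬ ((p : ℤ) ∣ a) then 1
  else if 2 ≤ k ∧ ¬ ((p : ℤ) ^ 2 ∣ a) then 1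
  else if k = 1 ∧ (p : ℤ) ∣ a then 1 - 1 / (p : ℝ)
  else 0

/-- The local factor `e(a, 2)`. -/
noncomputable def eTwo (a : ℤ) : ℝ :=
  if a % 4 = 1 then 1
  else if a % 16 = 8 ∨ a % 16 = 12 then 1
  else 0


def IsFund (D : ℤ) : Prop :=
  D ≠ 1 ∧ (D % 4 = 1 ∨ D % 16 = 8 ∨ D % 16 = 12) ∧ ∀ p : ℕ, p.Prime → p ≠ 2 → ¬ ((p : ℤ) ^ 2 ∣ D)

lemma IsFund.dvd_two {D : ℤ} (h : IsFund D) {y : ℕ} (hy : (y : ℤ) ^ 2 ∣ D) : y ∣ 2 := by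
  obtain ⟨h1, h2, h3⟩ := h
  have hD : D ≠ 0 := by rintro rfl; simp at h2
  have hy0 : y ≠ 0 := by rintro rfl; simp at hy; exact hD hy
  have hp : ∀ p : ℕ, p.Prime → p ∣ y → p = 2 := by
    intro p hp hpy
    by_contra hne
    exact h3 p hp hne ((pow_dvd_pow_of_dvd (Int.natCast_dvd_natCast.2 hpy) 2).trans hy)
  have h2' : y = 2 ^ y.primeFactorsList.length := Nat.eq_prime_pow_of_unique_prime_dvd hy0 (fun {d} hd hdy => hp d hd hdy)
  generalize y.primeFactorsList.length = k at h2'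
  rcases k with _ | _ | k
  · simp [h2']
  · simp [h2']
  · exfalso
    have : (16 : ℤ) ∣ D := by
      refine Dvd.dvd.trans ⟨(2:ℤ) ^ (2*k), ?_⟩ hy
      rw [h2']; push_cast; ring
    omega

lemma IsFund.not_sq {D : ℤ} (h : IsFund D) (r : ℚ) : r ^ 2 ≠ D := by
  intro hr
  have hi : IsIntegral ℤ r := by
    refine IsIntegral.of_pow (n := 2) (by norm_num) ?_
    rw [hr]; exact isIntegral_algebraMap (R := ℤ) (A := ℚ) (x := D)
  obtain ⟨n, rfl⟩ := IsIntegrallyClosed.isIntegral_iff.1 hi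
  have hn : n ^ 2 = D := by
    simp only [eq_intCast] at hr
    exact_mod_cast hr
  have : (n.natAbs : ℤ) ^ 2 ∣ D := by simp [hn]
  have h2 := Nat.le_of_dvd (by norm_num) (h.dvd_two this)
  obtain ⟨h1, h2', h3⟩ := h
  have : n ≤ 2 := by omega
  have : -2 ≤ n := by omega
  interval_cases n <;> subst hn <;> simp at h1 h2'

abbrev QF (D : ℤ) := QuadraticAlgebra ℚ (((D - D % 2) / 4 : ℤ) : ℚ) ((D % 2 : ℤ) : ℚ)

lemma IsFund.eq {D : ℤ} (h : IsFund D) : (D % 2) ^ 2 + 4 * ((D - D % 2) / 4) = D := by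
  obtain ⟨h1, h2', h3⟩ := h
  rcases Int.emod_two_eq_zero_or_one D with h | h <;> rw [h] <;> omega

lemma IsFund.eqQ {D : ℤ} (h : IsFund D) :
   ((D % 2 : ℤ) : ℚ) ^ 2 + 4 * (((D - D % 2) / 4 : ℤ) : ℚ) = D := by
  exact_mod_cast h.eq

lemma IsFund.fact {D : ℤ} (h : IsFund D) :
    Fact (∀ r : ℚ, r ^ 2 ≠ (((D - D % 2) / 4 : ℤ) : ℚ) + ((D % 2 : ℤ) : ℚ) * r) := by
  constructor
  intro r hr
  apply h.not_sq (2 * r - ((D % 2 : ℤ) : ℚ))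
  rw [← h.eqQ]
  linear_combination 4 * hr

lemma int_of_quad {D : ℤ} (h : IsFund D) (z : QF D) (hz : IsIntegral ℤ z) :
    IsIntegral ℤ z.re ∧ IsIntegral ℤ z.im := by
  have := h.fact
  have hstar : IsIntegral ℤ (star z) := hz.map (starRingEnd (QF D)).toIntAlgHom
  have ht : IsIntegral ℤ z.trace := by
    have := hz.add hstar
    rw [← QuadraticAlgebra.algebraMap_trace_eq_add_star] at this
    exact (isIntegral_algebraMap_iff (FaithfulSMul.algebraMap_injective ℚ (QF D))).1 this
  have hn : IsIntegral ℤ z.norm := by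
    have := hz.mul hstar
    rw [← QuadraticAlgebra.algebraMap_norm_eq_mul_star] at this
    exact (isIntegral_algebraMap_iff (FaithfulSMul.algebraMap_injective ℚ (QF D))).1 this
  obtain ⟨t, ht'⟩ := IsIntegrallyClosed.isIntegral_iff.1 ht
  obtain ⟨n, hn'⟩ := IsIntegrallyClosed.isIntegral_iff.1 hn
  have key : (D : ℚ) * z.im ^ 2 = t ^ 2 - 4 * n := by
    simp only [eq_intCast] at ht' hn'
    rw [ht', hn', ← h.eqQ, QuadraticAlgebra.trace_def, QuadraticAlgebra.norm_def]
    ring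
  have hden : z.im.den ∣ 2 := by
    apply h.dvd_two
    have h1 : D * z.im.num ^ 2 = (t ^ 2 - 4 * n) * (z.im.den : ℤ) ^ 2 := by
      have h0 : (z.im.den : ℚ) ≠ 0 := by exact_mod_cast z.im.den_nz
      have : (D : ℚ) * z.im.num ^ 2 = (t ^ 2 - 4 * n) * (z.im.den : ℚ) ^ 2 := by
        rw [← key]
        nth_rw 2 [← Rat.num_div_den z.im]
        field_simp
      exact_mod_cast this
    have h2 : (z.im.den : ℤ) ^ 2 ∣ D * z.im.num ^ 2 := ⟨t ^ 2 - 4 * n, by rw [h1]; ring⟩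
    refine IsCoprime.dvd_of_dvd_mul_right ?_ h2
    apply IsCoprime.pow
    rw [Int.isCoprime_iff_gcd_eq_one, Int.gcd_comm]
    exact z.im.reduced
  have him : IsIntegral ℤ z.im := by
    rcases (Nat.dvd_prime Nat.prime_two).1 hden with h1 | h2
    · rw [← Rat.num_div_den z.im, h1]
      simpa using isIntegral_algebraMap (R := ℤ) (A := ℚ) (x := z.im.num)
    · exfalso
      have hz2 : z.im = z.im.num / 2 := by
        conv_lhs => rw [← Rat.num_div_den z.im, h2]
        norm_num
      have hodd : z.im.num % 2 = 1 := by
        have := z.im.reduced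
        rw [h2] at this
        have := (Nat.coprime_two_right).1 this
        rw [Int.natAbs_odd] at this
        exact Int.odd_iff.1 this
      generalize z.im.num = x at hz2 hodd
      rw [hz2] at key
      have key' : D * x ^ 2 = 4 * (t ^ 2 - 4 * n) := by
        have : (D : ℚ) * x ^ 2 = 4 * (t ^ 2 - 4 * n) := by linear_combination 4 * key
        exact_mod_cast this
      obtain ⟨-, hm, -⟩ := h
      obtain ⟨y, rfl⟩ : ∃ y, x = 2 * y + 1 := ⟨x / 2, by omega⟩
      obtain ⟨w, hw⟩ := Int.even_mul_succ_self y
      have e1 : D * (8 * w + 1) = 4 * (t ^ 2 - 4 * n) := by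
        rw [← key']; linear_combination (-4 * D) * hw
      have h4 : t ^ 2 % 4 = 0 ∨ t ^ 2 % 4 = 1 := by
        rcases Int.even_or_odd' t with ⟨c, rfl | rfl⟩
        · left; ring_nf; omega
        · right; ring_nf; omega
      generalize t ^ 2 = T at *
      have e2 : D + 8 * (D * w) = 4 * T - 16 * n := by linarith
      obtain ⟨E, rfl⟩ : ∃ E, D = 4 * E := ⟨D / 4, by omega⟩
      have e3 : E + 8 * (E * w) = T - 4 * n := by linarith
      omega
  refine ⟨?_, him⟩
  -- re is a root
  obtain ⟨v, hv⟩ := IsIntegrallyClosed.isIntegral_iff.1 him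
  simp only [eq_intCast] at ht' hn' hv
  rw [QuadraticAlgebra.norm_def, ← hv] at hn'
  refine ⟨Polynomial.X ^ 2 + Polynomial.C ((D % 2) * v) * Polynomial.X -
    Polynomial.C (((D - D % 2) / 4) * v ^ 2 + n), ?_, ?_⟩
  · monicity!
  · simp only [Polynomial.eval₂_sub, Polynomial.eval₂_add, Polynomial.eval₂_mul,
      Polynomial.eval₂_pow, Polynomial.eval₂_X, Polynomial.eval₂_C]
    simp only [eq_intCast]
    rw [Int.cast_add, hn', Int.cast_mul, Int.cast_mul, Int.cast_pow]
    ring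


lemma basis_one (a b : ℚ) : QuadraticAlgebra.basis a b 0 = 1 := by
  apply (QuadraticAlgebra.basis a b).repr.injective
  ext i
  rw [Module.Basis.repr_self, QuadraticAlgebra.basis_repr_apply]
  fin_cases i <;> simp <;> rfl

lemma basis_omega (a b : ℚ) : QuadraticAlgebra.basis a b 1 = QuadraticAlgebra.omega := by
  apply (QuadraticAlgebra.basis a b).repr.injective
  ext i
  rw [Module.Basis.repr_self, QuadraticAlgebra.basis_repr_apply]
  fin_cases i <;> simp

lemma trace_QF {D : ℤ} (z : QF D) : Algebra.trace ℚ (QF D) z = z.trace := by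
  rw [Algebra.trace_eq_matrix_trace (QuadraticAlgebra.basis _ _), Matrix.trace_fin_two]
  simp [Algebra.leftMulMatrix_apply, LinearMap.toMatrix_apply, basis_one, basis_omega,
    QuadraticAlgebra.trace_def, QuadraticAlgebra.basis_repr_apply]
  ring

instance numberFieldQF {D : ℤ} [Fact (∀ r : ℚ, r ^ 2 ≠ (((D - D % 2) / 4 : ℤ) : ℚ) + ((D % 2 : ℤ) : ℚ) * r)] :
    NumberField (QF D) where
  to_charZero := charZero_of_injective_algebraMap (FaithfulSMul.algebraMap_injective ℚ (QF D))
  to_finiteDimensional := by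
    convert (inferInstance : Module.Finite ℚ (QF D))

lemma discr_QF {D : ℤ} (h : IsFund D) : 
    haveI := h.fact
    NumberField.discr (QF D) = D := by
  have := h.fact
  have e : (NumberField.discr (QF D) : ℚ) = D := by
    rw [NumberField.coe_discr]
    have hb : ∀ i, IsIntegral ℤ (QuadraticAlgebra.basis (((D - D % 2) / 4 : ℤ) : ℚ) ((D % 2 : ℤ) : ℚ) i) := by
      intro i
      fin_cases i
      · simp only [Fin.zero_eta, basis_one]
        exact isIntegral_one
      · simp only [Fin.mk_one, basis_omega]
        refine ⟨Polynomial.X ^ 2 - Polynomial.C (D % 2) * Polynomial.X -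
          Polynomial.C ((D - D % 2) / 4), ?_, ?_⟩
        · monicity!
        · simp only [Polynomial.eval₂_sub, Polynomial.eval₂_mul,
            Polynomial.eval₂_pow, Polynomial.eval₂_X, Polynomial.eval₂_C]
          rw [pow_two, QuadraticAlgebra.omega_mul_omega_eq_algebraMap]
          simp
    rw [Algebra.discr_eq_discr_of_toMatrix_coeff_isIntegral (QF D) (b' := QuadraticAlgebra.basis (((D - D % 2) / 4 : ℤ) : ℚ) ((D % 2 : ℤ) : ℚ))]
    · have ht : ∀ z : QF D, Algebra.trace ℚ (QF D) z = z.trace := by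
        intro z
        rw [← trace_QF]
        congr!
      rw [Algebra.discr_def, Matrix.det_fin_two]
      simp only [Algebra.traceMatrix_apply, Algebra.traceForm_apply, basis_one, basis_omega, ht]
      rw [← h.eqQ]
      have hre : (1 : QF D).re = 1 := rfl
      have him : (1 : QF D).im = 0 := rfl
      simp [QuadraticAlgebra.trace_def, hre, him]
      ring
    · intro i j
      rw [Module.Basis.toMatrix_apply]
      have := NumberField.integralBasis_repr_apply (QF D) ⟨_, hb j⟩ i
      erw [this]
      exact isIntegral_algebraMap
    · intro i j
      rw [Module.Basis.toMatrix_apply]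
      have := int_of_quad h (NumberField.integralBasis (QF D) j) (by
        rw [NumberField.integralBasis_apply]
        exact NumberField.RingOfIntegers.isIntegral_coe _)
      fin_cases i
      · exact this.1
      · exact this.2
  exact_mod_cast e

lemma exists_sqrt (K : Type*) [Field K] [NumberField K] (hK : Module.finrank ℚ K = 2) :
    ∃ (d : ℤ) (w : K), Squarefree d ∧ w ^ 2 = (d : K) ∧ ∀ q : ℚ, (q : K) ≠ w := by
  obtain ⟨x, hx⟩ : ∃ x : K, ∀ q : ℚ, (q : K) ≠ x := by
    by_contra! hcon
    have : (⊥ : Subalgebra ℚ K) = ⊤ := by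
      rw [eq_top_iff]
      intro x _
      obtain ⟨q, hq⟩ := hcon x
      exact Algebra.mem_bot.2 ⟨q, by simpa using hq⟩
    have := Subalgebra.bot_eq_top_iff_finrank_eq_one.1 this
    omega
  have hxint : IsIntegral ℚ x := Algebra.IsIntegral.isIntegral x
  have hle := minpoly.natDegree_le (A := ℚ) x
  rw [hK] at hle
  have hpos := minpoly.natDegree_pos hxint
  have hne1 : (minpoly ℚ x).natDegree ≠ 1 := by
    intro h1
    obtain ⟨q, hq⟩ := minpoly.mem_range_of_degree_eq_one ℚ x
      ((Polynomial.degree_eq_iff_natDegree_eq_of_pos one_pos).2 h1)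
    exact hx q (by simpa using hq)
  have h2 : (minpoly ℚ x).natDegree = 2 := by omega
  obtain ⟨c0, c1, hc⟩ : ∃ c0 c1 : ℚ, x ^ 2 + c1 * x + c0 = 0 := by
    refine ⟨(minpoly ℚ x).coeff 0, (minpoly ℚ x).coeff 1, ?_⟩
    have h := minpoly.aeval ℚ x
    have hm := minpoly.monic hxint
    rw [Polynomial.aeval_eq_sum_range, h2] at h
    have hl : (minpoly ℚ x).coeff 2 = 1 := by rw [← h2]; exact hm
    simp [Finset.sum_range_succ, hl, Algebra.smul_def] at h
    linear_combination h
  set q : ℚ := c1 ^ 2 - 4 * c0 with hq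
  have hy : (2 * x + c1) ^ 2 = (q : K) := by
    rw [hq]; push_cast; linear_combination 4 * hc
  have hden : (q.den : ℚ) ≠ 0 := by exact_mod_cast q.den_nz
  set n : ℤ := q.num * q.den with hn
  have hz : (q.den * (2 * x + c1)) ^ 2 = (n : K) := by
    rw [mul_pow, hy]
    have : (q.den : ℚ) ^ 2 * q = n := by
      nth_rw 2 [← Rat.num_div_den q]
      rw [hn]; push_cast; field_simp
    exact_mod_cast this
  have hzq : ∀ r : ℚ, (r : K) ≠ q.den * (2 * x + c1) := by
    intro r hr
    apply hx ((r / q.den - c1) / 2)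
    have h1 : (q.den : K) ≠ 0 := by exact_mod_cast q.den_nz
    push_cast
    rw [hr]
    field_simp
    ring
  have hn0 : n ≠ 0 := by
    intro h0
    rw [h0] at hz
    apply hzq 0
    have := pow_eq_zero_iff (two_ne_zero) |>.1 (hz.trans Int.cast_zero)
    rw [this]; simp
  obtain ⟨a, b, ha, hb, hab, hsq⟩ := Nat.sq_mul_squarefree_of_pos (Int.natAbs_pos.2 hn0)
  have hb' : (b : K) ≠ 0 := by exact_mod_cast hb.ne'
  refine ⟨n.sign * a, (q.den * (2 * x + c1)) / b, ?_, ?_, ?_⟩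
  · rw [← Int.squarefree_natAbs, Int.natAbs_mul, Int.natAbs_sign_of_ne_zero hn0]
    simpa using hsq
  · rw [div_pow, hz]
    have : n = n.sign * a * b ^ 2 := by
      conv_lhs => rw [← Int.sign_mul_natAbs n, ← hab]
      push_cast; ring
    have h2 : (n : K) = (n.sign * a : ℤ) * b ^ 2 := by
      conv_lhs => rw [this]
      push_cast; ring
    rw [h2]
    field_simp
  · intro r hr
    apply hzq (r * b)
    push_cast
    rw [hr]; field_simp

lemma exists_equiv (K : Type*) [Field K] [NumberField K] (hK : Module.finrank ℚ K = 2) :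
    ∃ D : ℤ, ∃ _ : IsFund D, Nonempty (QF D ≃+* K) := by
  obtain ⟨d, w, hd, hw, hq⟩ := exists_sqrt K hK
  have hd0 := hd.ne_zero
  have hd1 : d ≠ 1 := by
    rintro rfl
    have : (w - 1) * (w + 1) = 0 := by
      push_cast at hw; linear_combination hw
    rcases mul_eq_zero.1 this with h | h
    · apply hq 1; push_cast; linear_combination -h
    · apply hq (-1); push_cast; linear_combination -h
  have hp : ∀ p : ℕ, p.Prime → ¬ ((p:ℤ) ^ 2 ∣ d) := by
    intro p hp hpd
    rw [pow_two] at hpd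
    have := hd _ hpd
    rw [Int.isUnit_iff_natAbs_eq] at this
    exact hp.ne_one (by simpa using this)
  have h4 : ¬ (4 : ℤ) ∣ d := by
    have := hp 2 Nat.prime_two
    norm_num at this; exact this
  -- a general transfer statement
  have main : ∀ (D : ℤ) (h : IsFund D) (u : K),
      u * u = (((D - D % 2) / 4 : ℤ) : ℚ) • (1 : K) + ((D % 2 : ℤ) : ℚ) • u →
      Nonempty (QF D ≃+* K) := by
    intro D h u hu
    have := h.fact
    let f : QF D →ₐ[ℚ] K := QuadraticAlgebra.lift ⟨u, hu⟩
    have hf : Function.Injective f := RingHom.injective f.toRingHom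
    have hs : Function.Surjective f.toLinearMap := by
      apply (LinearMap.injective_iff_surjective_of_finrank_eq_finrank _).1 hf
      rw [hK]
      exact QuadraticAlgebra.finrank_eq_two _ _
    exact ⟨RingEquiv.ofBijective f ⟨hf, hs⟩⟩
  by_cases hm : d % 4 = 1
  · have hF : IsFund d := ⟨hd1, Or.inl hm, fun p hp' _ => hp p hp'⟩
    refine ⟨d, hF, main d hF ((1 + w) / 2) ?_⟩
    have h2 : d % 2 = 1 := by omega
    have e : (((d - d % 2) / 4 : ℤ) : ℚ) = ((d : ℚ) - 1) / 4 := by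
      have := hF.eqQ
      rw [h2] at this ⊢
      push_cast at this ⊢
      linarith
    rw [e, h2]
    simp only [Algebra.smul_def, eq_ratCast]
    push_cast
    linear_combination hw / 4
  · have hF : IsFund (4 * d) := by
      refine ⟨by omega, by omega, fun p hp' h2 hdv => hp p hp' ?_⟩
      refine IsCoprime.dvd_of_dvd_mul_left ?_ hdv
      have : IsCoprime (p : ℤ) 2 := by
        rw [Int.isCoprime_iff_gcd_eq_one]
        exact (Nat.coprime_primes hp' Nat.prime_two).2 h2
      have := this.pow (m := 2) (n := 2)
      norm_num at this ⊢; exact this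
    refine ⟨4 * d, hF, main _ hF w ?_⟩
    have h2 : (4 * d) % 2 = 0 := by omega
    have e : (4 * d - 0) / 4 = d := by omega
    rw [h2, e]
    simp only [Algebra.smul_def, eq_ratCast]
    push_cast
    linear_combination hw

lemma subDisc_eq (K : Subfield ℂ) [NumberField K] : subDisc K = NumberField.discr K := by
  have h : FiniteDimensional ℚ K := NumberField.to_finiteDimensional
  rw [subDisc, dif_pos h]

lemma subfield_data (K : Subfield ℂ) (hK : Module.finrank ℚ K = 2) :
    IsFund (subDisc K) ∧ Nonempty (QF (subDisc K) ≃+* K) := by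
  have : FiniteDimensional ℚ K := Module.finite_of_finrank_pos (by omega)
  have : NumberField K := ⟨⟩
  obtain ⟨D, hD, ⟨f⟩⟩ := exists_equiv K hK
  have := hD.fact
  have e : subDisc K = D := by
    rw [subDisc_eq, ← discr_QF hD]
    exact (NumberField.discr_eq_discr_of_ringEquiv _ f).symm
  rw [e]
  exact ⟨hD, ⟨f⟩⟩

lemma exists_subfield (D : ℤ) (hD : IsFund D) :
    ∃ K : Subfield ℂ, Module.finrank ℚ K = 2 ∧ subDisc K = D := by
  have := hD.fact
  obtain ⟨s, hs⟩ := IsAlgClosed.exists_pow_nat_eq ((D : ℂ)) (n := 2) (by norm_num)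
  have hu : ((((D % 2 : ℤ) : ℂ) + s) / 2) * ((((D % 2 : ℤ) : ℂ) + s) / 2) =
     (((D - D % 2) / 4 : ℤ) : ℚ) • (1 : ℂ) + ((D % 2 : ℤ) : ℚ) • ((((D % 2 : ℤ) : ℂ) + s) / 2) := by
    simp only [Algebra.smul_def, eq_ratCast]
    have e : ((D % 2 : ℤ) : ℂ) ^ 2 + 4 * (((D - D % 2) / 4 : ℤ) : ℂ) = D := by
      exact_mod_cast hD.eq
    rw [Rat.cast_intCast, Rat.cast_intCast]
    linear_combination hs / 4 - e / 4
  let f : QF D →ₐ[ℚ] ℂ := QuadraticAlgebra.lift ⟨_, hu⟩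
  let g : QF D ≃+* f.toRingHom.fieldRange := 
    RingEquiv.ofBijective f.toRingHom.rangeRestrictField 
      f.toRingHom.rangeRestrictField_bijective
  have : NumberField f.toRingHom.fieldRange := NumberField.of_ringEquiv _ _ g
  refine ⟨f.toRingHom.fieldRange, ?_, ?_⟩
  · rw [← QuadraticAlgebra.finrank_eq_two (((D - D % 2) / 4 : ℤ) : ℚ) ((D % 2 : ℤ) : ℚ)]
    let g' : QF D ≃ₗ[ℚ] f.toRingHom.fieldRange := g.toAddEquiv.toLinearEquiv (fun c x => map_rat_smul g c x)
    exact g'.finrank_eq.symm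
  · rw [subDisc_eq]
    exact (NumberField.discr_eq_discr_of_ringEquiv _ g).symm.trans (discr_QF hD)

lemma countFields_eq (Q : ℤ → Prop) :
    countFields (fun K => Module.finrank ℚ K = 2 ∧ Q (subDisc K)) =
      Nat.card {D : ℤ // IsFund D ∧ Q D} := by
  unfold countFields
  apply Nat.card_congr
  refine Equiv.ofBijective (Quot.lift (fun K => ⟨subDisc K.1, (subfield_data K.1 K.2.1).1, K.2.2⟩) ?_) ⟨?_, ?_⟩
  · rintro ⟨K, hK, hQ⟩ ⟨L, hL, hQ'⟩ ⟨f⟩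
    have : FiniteDimensional ℚ K := Module.finite_of_finrank_pos (by omega)
    have : NumberField K := ⟨⟩
    have : FiniteDimensional ℚ L := Module.finite_of_finrank_pos (by omega)
    have : NumberField L := ⟨⟩
    apply Subtype.ext
    simp only [subDisc_eq]
    exact NumberField.discr_eq_discr_of_ringEquiv _ f
  · rintro ⟨K, hK, hQ⟩ ⟨L, hL, hQ'⟩ h
    have h : subDisc K = subDisc L := congrArg Subtype.val h
    apply Quot.sound
    obtain ⟨h1, ⟨f⟩⟩ := subfield_data K hK
    obtain ⟨h2, ⟨g⟩⟩ := subfield_data L hL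
    rw [← h] at g
    exact ⟨f.symm.trans g⟩
  · rintro ⟨D, hD, hQ⟩
    obtain ⟨K, hK, rfl⟩ := exists_subfield D hD
    exact ⟨Quot.mk _ ⟨K, hK, hQ⟩, rfl⟩

open ArithmeticFunction in
def gg (m : ℕ) (b : ℤ) (d : ℕ) : ℝ :=
  if Odd d ∧ ((Nat.gcd m (d ^ 2) : ℕ) : ℤ) ∣ b then
    (moebius d : ℝ) * ((Nat.gcd m (d ^ 2) : ℕ) : ℝ) / (d : ℝ) ^ 2 else 0

def OddSqfree (n : ℤ) : Prop := ∀ p : ℕ, p.Prime → p ≠ 2 → ¬ ((p : ℤ) ^ 2 ∣ n)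

lemma sum_moebius_sq (n : ℕ) (hn : 0 < n) (M : ℕ) (hM : ∀ d : ℕ, d ^ 2 ∣ n → d ≤ M) :
    ∑ d ∈ Finset.Icc 1 M, (if Odd d ∧ d ^ 2 ∣ n then ArithmeticFunction.moebius d else 0) =
      if OddSqfree n then 1 else 0 := by
  obtain ⟨a, b, ha, hb, hab, hsq⟩ := Nat.sq_mul_squarefree_of_pos hn
  obtain ⟨k, c, hc, hkc⟩ := Nat.exists_eq_two_pow_mul_odd hb.ne'
  have hc0 : c ≠ 0 := by rintro rfl; simp at hc
  have hdvd : ∀ d : ℕ, d ^ 2 ∣ n ↔ d ∣ b := by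
    intro d
    constructor
    · intro h
      rw [← hab] at h
      have hd0 : d ≠ 0 := by
        rintro rfl
        have := Nat.pos_of_ne_zero (mul_ne_zero (pow_ne_zero 2 hb.ne') ha.ne')
        simp at h; omega
      rw [← Nat.factorization_le_iff_dvd hd0 hb.ne']
      have h2 := (Nat.factorization_le_iff_dvd (pow_ne_zero 2 hd0) (mul_ne_zero (pow_ne_zero 2 hb.ne') ha.ne')).2 h
      intro p
      have h3 := h2 p
      rw [Nat.factorization_mul (pow_ne_zero 2 hb.ne') ha.ne', Nat.factorization_pow, Nat.factorization_pow] at h3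
      have h4 := hsq.natFactorization_le_one p
      simp at h3
      omega
    · intro h
      rw [← hab]
      exact (pow_dvd_pow_of_dvd h 2).mul_right _
  have hodd : ∀ d : ℕ, Odd d ∧ d ^ 2 ∣ n ↔ d ∣ c := by
    intro d
    rw [hdvd, hkc]
    constructor
    · rintro ⟨h1, h2⟩
      exact Nat.Coprime.dvd_of_dvd_mul_left ((Nat.coprime_two_right.2 h1).pow_right k) h2
    · intro h
      exact ⟨hc.of_dvd_nat h, h.mul_left _⟩
  simp_rw [hodd]
  rw [← Finset.sum_filter]
  have hset : Finset.filter (fun d => d ∣ c) (Finset.Icc 1 M) = c.divisors := by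
    ext d
    simp only [Finset.mem_filter, Finset.mem_Icc, Nat.mem_divisors]
    constructor
    · rintro ⟨-, h⟩; exact ⟨h, hc0⟩
    · rintro ⟨h, -⟩
      refine ⟨⟨?_, hM d ((hodd d).2 h).2⟩, h⟩
      exact Nat.pos_of_dvd_of_pos h (Nat.pos_of_ne_zero hc0)
  rw [hset, ← ArithmeticFunction.coe_mul_zeta_apply, ArithmeticFunction.moebius_mul_coe_zeta,
    ArithmeticFunction.one_apply]
  congr 1
  rw [eq_iff_iff]
  unfold OddSqfree
  constructor
  · rintro rfl p hp hp2 hdv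
    have : p ∣ 1 := (hodd p).1 ⟨hp.odd_of_ne_two hp2, by exact_mod_cast hdv⟩
    exact hp.one_lt.ne' (Nat.dvd_one.1 this)
  · intro h
    by_contra hne
    obtain ⟨p, hp, hpc⟩ := Nat.exists_prime_and_dvd hne
    have := (hodd p).2 hpc
    refine h p hp ?_ (by exact_mod_cast this.2)
    rintro rfl
    exact absurd this.1 (by decide)

lemma count_modEq (N : ℤ) (hN : 0 ≤ N) (v : ℤ) (r : ℤ) (hr : 0 < r) :
    |((Finset.filter (fun x => x ≡ v [ZMOD r]) (Finset.Ioc 0 N)).card : ℝ) - (N : ℝ) / r| ≤ 1 := by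
  have h := Int.Ioc_filter_modEq_card 0 N hr v
  have hr' : (0 : ℚ) < r := by exact_mod_cast hr
  have hN' : (0 : ℚ) ≤ (N : ℚ) / r := by positivity
  have e : ((N : ℚ) - v) / r = N / r + (-v) / r := by ring
  have e0 : (((0 : ℤ) : ℚ) - v) / r = (-v) / r := by push_cast; ring
  rw [e, e0] at h
  set A := ⌊(N : ℚ) / r + (-v) / r⌋ 
  set B := ⌊(-v : ℚ) / r⌋
  have a1 : (A : ℚ) ≤ (N : ℚ) / r + (-v) / r := Int.floor_le _
  have a2 : (N : ℚ) / r + (-v) / r < A + 1 := Int.lt_floor_add_one _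
  have b1 : (B : ℚ) ≤ (-v : ℚ) / r := Int.floor_le _
  have b2 : (-v : ℚ) / r < B + 1 := Int.lt_floor_add_one _
  have key : |((Finset.filter (fun x => x ≡ v [ZMOD r]) (Finset.Ioc 0 N)).card : ℚ) - (N : ℚ) / r| ≤ 1 := by
    have h' : ((Finset.filter (fun x => x ≡ v [ZMOD r]) (Finset.Ioc 0 N)).card : ℚ) = max ((A : ℚ) - B) 0 := by
      have : (((Finset.filter (fun x => x ≡ v [ZMOD r]) (Finset.Ioc 0 N)).card : ℤ) : ℚ) = ((max (A - B) 0 : ℤ) : ℚ) := by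
        rw [← h]; 
      push_cast at this
      exact this
    rw [h']
    rcases max_cases ((A : ℚ) - B) 0 with ⟨h1, h2⟩ | ⟨h1, h2⟩ <;> rw [h1, abs_le] <;> constructor <;> linarith
  exact_mod_cast key

lemma count_crt (m : ℕ) (hm : 0 < m) (b : ℤ) (N : ℤ) (hN : 0 ≤ N) (d : ℕ) (hd : 0 < d) :
    |((Finset.filter (fun x => (m : ℤ) ∣ x - b ∧ (d : ℤ) ^ 2 ∣ x) (Finset.Ioc 0 N)).card : ℝ) -
      (if ((Nat.gcd m (d ^ 2) : ℕ) : ℤ) ∣ b then (N : ℝ) * ((Nat.gcd m (d ^ 2) : ℕ) : ℝ) / (m * (d : ℝ) ^ 2) else 0)| ≤ 1 := by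
  split_ifs with h
  · obtain ⟨k, hk⟩ := h
    have hbz := Nat.gcd_eq_gcd_ab m (d ^ 2)
    set g := Nat.gcd m (d ^ 2)
    set x := Nat.gcdA m (d ^ 2)
    set y := Nat.gcdB m (d ^ 2)
    push_cast at hbz
    have hl : 0 < Nat.lcm m (d ^ 2) := Nat.lcm_pos hm (by positivity)
    have hc := count_modEq N hN ((d : ℤ) ^ 2 * y * k) (Nat.lcm m (d ^ 2) : ℕ) (by exact_mod_cast hl)
    have hs : Finset.filter (fun x => (m : ℤ) ∣ x - b ∧ (d : ℤ) ^ 2 ∣ x) (Finset.Ioc 0 N) =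
      Finset.filter (fun x => x ≡ (d : ℤ) ^ 2 * y * k [ZMOD (Nat.lcm m (d ^ 2) : ℕ)]) (Finset.Ioc 0 N) := by
      apply Finset.filter_congr
      intro n _
      rw [Int.modEq_comm, Int.modEq_iff_dvd, Int.natCast_dvd (m := Nat.lcm m (d ^ 2)), Nat.lcm_dvd_iff, ← Int.natCast_dvd, ← Int.natCast_dvd]
      push_cast
      have e1 : n - (d : ℤ) ^ 2 * y * k = (n - b) + m * (x * k) := by
        rw [hk, hbz]; ring
      apply and_congr
      · rw [e1]; exact (dvd_add_left (dvd_mul_right _ _)).symm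
      · rw [mul_assoc]; exact (dvd_sub_left (dvd_mul_right _ _)).symm
    rw [hs]
    have e : (N : ℝ) * (g : ℝ) / (m * (d : ℝ) ^ 2) = N / (((Nat.lcm m (d ^ 2) : ℕ) : ℤ) : ℝ) := by
      have h1 : (g : ℝ) * (Nat.lcm m (d ^ 2) : ℕ) = m * (d : ℝ) ^ 2 := by
        exact_mod_cast Nat.gcd_mul_lcm m (d ^ 2)
      have hm' : (m : ℝ) ≠ 0 := by positivity
      have hd' : (d : ℝ) ≠ 0 := by positivity
      have hl' : ((Nat.lcm m (d ^ 2) : ℕ) : ℝ) ≠ 0 := by positivity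
      rw [Int.cast_natCast, div_eq_div_iff (by positivity) hl', ← h1]
      ring
    rw [e]
    exact hc
  · have : Finset.filter (fun x => (m : ℤ) ∣ x - b ∧ (d : ℤ) ^ 2 ∣ x) (Finset.Ioc 0 N) = ∅ := by
      apply Finset.filter_eq_empty_iff.2
      rintro x - ⟨h1, h2⟩
      apply h
      have g1 : ((Nat.gcd m (d ^ 2) : ℕ) : ℤ) ∣ x - b := (Int.natCast_dvd_natCast.2 (Nat.gcd_dvd_left _ _)).trans h1
      have g2 : ((Nat.gcd m (d ^ 2) : ℕ) : ℤ) ∣ x := by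
        refine (Int.natCast_dvd_natCast.2 (Nat.gcd_dvd_right m (d ^ 2))).trans ?_
        push_cast; exact h2
      exact (dvd_sub_right g2).1 g1
    rw [this]; simp

lemma gg_abs_le (m : ℕ) (b : ℤ) (d : ℕ) (hm : 0 < m) : |gg m b d| ≤ m * ((d : ℝ) ^ 2)⁻¹ := by
  unfold gg
  split_ifs with h
  · rw [abs_div, abs_mul, div_eq_mul_inv, abs_of_nonneg (by positivity : (0:ℝ) ≤ (d:ℝ) ^ 2)]
    gcongr
    have h1 : |(ArithmeticFunction.moebius d : ℝ)| ≤ 1 := by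
      exact_mod_cast ArithmeticFunction.abs_moebius_le_one
    have h2 : |((Nat.gcd m (d ^ 2) : ℕ) : ℝ)| ≤ m := by
      rw [abs_of_nonneg (by positivity)]
      exact_mod_cast Nat.gcd_le_left _ hm
    calc _ ≤ 1 * (m : ℝ) := by gcongr
      _ = m := one_mul _
  · simp; positivity

lemma gg_summable (m : ℕ) (b : ℤ) (hm : 0 < m) : Summable (fun d => ‖gg m b d‖) := by
  refine Summable.of_nonneg_of_le (fun _ => norm_nonneg _) (fun d => gg_abs_le m b d hm) ?_
  exact (Real.summable_nat_pow_inv.2 (by norm_num)).mul_left _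

lemma gg_tail (m : ℕ) (b : ℤ) (hm : 0 < m) (M : ℕ) :
    |∑' d, gg m b d - ∑ d ∈ Finset.Icc 1 M, gg m b d| ≤ 2 * m / (M + 1) := by
  have hs : Summable (gg m b) := (gg_summable m b hm).of_norm
  have ht := (hs.hasSum.sub (hasSum_sum_of_ne_finset_zero (f := fun d => if d ∈ Finset.Icc 1 M then gg m b d else 0) (s := Finset.Icc 1 M)
    (fun d hd => if_neg hd))).tendsto_sum_nat
  have e1 : ∑ d ∈ Finset.Icc 1 M, (if d ∈ Finset.Icc 1 M then gg m b d else 0) = ∑ d ∈ Finset.Icc 1 M, gg m b d :=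
    Finset.sum_congr rfl (fun d hd => if_pos hd)
  rw [e1] at ht
  refine le_of_tendsto ht.abs (Filter.Eventually.of_forall fun n => ?_)
  have e2 : ∀ d, gg m b d - (if d ∈ Finset.Icc 1 M then gg m b d else 0) = if M < d then gg m b d else 0 := by
    intro d
    by_cases h0 : d = 0
    · subst h0; simp [gg]
    · by_cases hd : d ≤ M
      · rw [if_pos (Finset.mem_Icc.2 ⟨by omega, hd⟩), if_neg (by omega), sub_self]
      · rw [if_neg (by simp; omega), if_pos (by omega), sub_zero]
  simp_rw [e2]
  rw [← Finset.sum_filter]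
  have e3 : Finset.filter (fun d => M < d) (Finset.range n) = Finset.Ioo M n := by
    ext d; simp; tauto
  rw [e3]
  calc _ ≤ ∑ d ∈ Finset.Ioo M n, |gg m b d| := Finset.abs_sum_le_sum_abs _ _
    _ ≤ ∑ d ∈ Finset.Ioo M n, m * ((d : ℝ) ^ 2)⁻¹ := Finset.sum_le_sum fun d _ => gg_abs_le m b d hm
    _ = m * ∑ d ∈ Finset.Ioo M n, ((d : ℝ) ^ 2)⁻¹ := by rw [Finset.mul_sum]
    _ ≤ m * (2 / (M + 1)) := by gcongr; exact sum_Ioo_inv_sq_le M n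
    _ = _ := by ring

lemma sieve (m : ℕ) (hm : 0 < m) (b : ℤ) (X : ℝ) (hX : 1 ≤ X) :
    |((Finset.filter (fun x => (m : ℤ) ∣ x - b ∧ OddSqfree x) (Finset.Ioc 0 (⌈X⌉ - 1))).card : ℝ) -
      X / m * ∑' d, gg m b d| ≤ 4 * Real.sqrt X := by
  set N := ⌈X⌉ - 1 with hNdef
  have hN1 : (N : ℝ) < X := by
    rw [hNdef]; push_cast; linarith [Int.ceil_lt_add_one X]
  have hN2 : X - 1 ≤ N := by
    rw [hNdef]; push_cast; linarith [Int.le_ceil X]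
  have hN : 0 ≤ N := by
    have : (0 : ℤ) < ⌈X⌉ := Int.ceil_pos.2 (by linarith)
    omega
  set M := ⌊Real.sqrt X⌋₊ with hM
  have hM1 : (M : ℝ) ≤ Real.sqrt X := Nat.floor_le (Real.sqrt_nonneg X)
  have hM2 : Real.sqrt X < M + 1 := Nat.lt_floor_add_one _
  have hm' : (0 : ℝ) < m := by exact_mod_cast hm
  have hsX : 0 < Real.sqrt X := Real.sqrt_pos.2 (by linarith)
  have hsq : Real.sqrt X * Real.sqrt X = X := Real.mul_self_sqrt (by linarith)
  -- expand
  have hexp : ((Finset.filter (fun x => (m : ℤ) ∣ x - b ∧ OddSqfree x) (Finset.Ioc 0 N)).card : ℤ) =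
      ∑ d ∈ Finset.Icc 1 M, (if Odd d then ArithmeticFunction.moebius d else 0) *
        ((Finset.filter (fun x => (m : ℤ) ∣ x - b ∧ (d : ℤ) ^ 2 ∣ x) (Finset.Ioc 0 N)).card : ℤ) := by
    rw [Finset.card_filter]
    simp_rw [Finset.card_filter]
    push_cast
    simp_rw [Finset.mul_sum]
    rw [Finset.sum_comm]
    apply Finset.sum_congr rfl
    intro x hx
    rw [Finset.mem_Ioc] at hx
    lift x to ℕ using hx.1.le
    have hx0 : 0 < x := by exact_mod_cast hx.1
    have h := sum_moebius_sq x hx0 M (by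
      intro d hd
      rw [hM]
      apply Nat.le_floor
      apply Real.le_sqrt_of_sq_le
      have h1 : d ^ 2 ≤ x := Nat.le_of_dvd hx0 hd
      have h2 : ((x : ℤ) : ℝ) ≤ N := by exact_mod_cast hx.2
      have h3 : ((d : ℝ)) ^ 2 ≤ x := by exact_mod_cast h1
      push_cast at h2
      linarith)
    by_cases hxb : (m : ℤ) ∣ (x : ℤ) - b
    · simp only [hxb, true_and]
      rw [← h]
      apply Finset.sum_congr rfl
      intro d _
      have : ((d : ℤ) ^ 2 ∣ (x : ℤ)) ↔ d ^ 2 ∣ x := by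
        rw [← Int.natCast_dvd_natCast]; push_cast; rfl
      simp only [this]
      by_cases h1 : Odd d <;> by_cases h2 : d ^ 2 ∣ x <;> simp [h1, h2]
    · simp [hxb]
  have hexp' : ((Finset.filter (fun x => (m : ℤ) ∣ x - b ∧ OddSqfree x) (Finset.Ioc 0 N)).card : ℝ) =
      ∑ d ∈ Finset.Icc 1 M, ((if Odd d then ArithmeticFunction.moebius d else 0 : ℤ) : ℝ) *
        ((Finset.filter (fun x => (m : ℤ) ∣ x - b ∧ (d : ℤ) ^ 2 ∣ x) (Finset.Ioc 0 N)).card : ℝ) := by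
    exact_mod_cast hexp
  have hfin : |((Finset.filter (fun x => (m : ℤ) ∣ x - b ∧ OddSqfree x) (Finset.Ioc 0 N)).card : ℝ) -
      (N : ℝ) / m * ∑ d ∈ Finset.Icc 1 M, gg m b d| ≤ M := by
    rw [hexp', Finset.mul_sum, ← Finset.sum_sub_distrib]
    calc _ ≤ ∑ d ∈ Finset.Icc 1 M, (1 : ℝ) := ?_
      _ = M := by simp
    refine (Finset.abs_sum_le_sum_abs _ _).trans (Finset.sum_le_sum fun d hd => ?_)
    have hd1 : 0 < d := (Finset.mem_Icc.1 hd).1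
    have hc := count_crt m hm b N hN d hd1
    set c : ℝ := ((Finset.filter (fun x => (m : ℤ) ∣ x - b ∧ (d : ℤ) ^ 2 ∣ x) (Finset.Ioc 0 N)).card : ℝ)
    have e : (N : ℝ) / m * gg m b d = ((if Odd d then ArithmeticFunction.moebius d else 0 : ℤ) : ℝ) *
      (if ((Nat.gcd m (d ^ 2) : ℕ) : ℤ) ∣ b then (N : ℝ) * ((Nat.gcd m (d ^ 2) : ℕ) : ℝ) / (m * (d : ℝ) ^ 2) else 0) := by
      unfold gg
      by_cases h1 : Odd d
      · by_cases h2 : ((Nat.gcd m (d ^ 2) : ℕ) : ℤ) ∣ b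
        · rw [if_pos ⟨h1, h2⟩, if_pos h1, if_pos h2]
          field_simp
        · rw [if_neg (fun h => h2 h.2), if_neg h2]; simp
      · rw [if_neg (fun h => h1 h.1), if_neg h1]; simp
    rw [e, ← mul_sub, abs_mul]
    have h1 : |((if Odd d then ArithmeticFunction.moebius d else 0 : ℤ) : ℝ)| ≤ 1 := by
      split_ifs
      · exact_mod_cast ArithmeticFunction.abs_moebius_le_one
      · simp
    calc _ ≤ (1 : ℝ) * 1 := by gcongr
      _ = 1 := one_mul 1
  have hG : |∑ d ∈ Finset.Icc 1 M, gg m b d| ≤ m * M := by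
    calc _ ≤ ∑ d ∈ Finset.Icc 1 M, (m : ℝ) := ?_
      _ = m * M := by simp [mul_comm]
    refine (Finset.abs_sum_le_sum_abs _ _).trans (Finset.sum_le_sum fun d hd => ?_)
    have hd1 : (1 : ℝ) ≤ d := by exact_mod_cast (Finset.mem_Icc.1 hd).1
    refine (gg_abs_le m b d hm).trans ?_
    have : ((d : ℝ) ^ 2)⁻¹ ≤ 1 := inv_le_one_of_one_le₀ (one_le_pow₀ hd1)
    nlinarith
  have ht := gg_tail m b hm M
  set S := ∑ d ∈ Finset.Icc 1 M, gg m b d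
  set G := ∑' d, gg m b d
  set c : ℝ := ((Finset.filter (fun x => (m : ℤ) ∣ x - b ∧ OddSqfree x) (Finset.Ioc 0 N)).card : ℝ)
  have hdec : c - X / m * G = (c - N / m * S) - (X - N) / m * S - X / m * (G - S) := by ring
  rw [hdec]
  have t2 : |(X - N) / m * S| ≤ M := by
    rw [abs_mul, abs_of_nonneg (div_nonneg (by linarith) hm'.le)]
    calc (X - N) / m * |S| ≤ 1 / m * (m * M) := by
          gcongr
          linarith
      _ = M := by field_simp
  have t3 : |X / m * (G - S)| ≤ 2 * Real.sqrt X := by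
    rw [abs_mul, abs_of_nonneg (by positivity)]
    calc X / m * |G - S| ≤ X / m * (2 * m / (M + 1)) := by gcongr
      _ ≤ X / m * (2 * m / Real.sqrt X) := by gcongr
      _ = 2 * Real.sqrt X := by
        field_simp
        nlinarith
  calc _ ≤ |c - N / m * S| + |(X - N) / m * S| + |X / m * (G - S)| := by
        refine (abs_sub _ _).trans ?_
        gcongr
        exact abs_sub _ _
    _ ≤ _ := by linarith

lemma gg_one (m : ℕ) (b : ℤ) : gg m b 1 = 1 := by simp [gg]

lemma gg_mul (m : ℕ) (b : ℤ) {x y : ℕ} (h : Nat.Coprime x y) :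
    gg m b (x * y) = gg m b x * gg m b y := by
  unfold gg
  have hc : Nat.Coprime (x ^ 2) (y ^ 2) := h.pow 2 2
  have hg : Nat.gcd m ((x * y) ^ 2) = Nat.gcd m (x ^ 2) * Nat.gcd m (y ^ 2) := by
    rw [mul_pow, hc.gcd_mul]
  have hgc : IsCoprime ((Nat.gcd m (x ^ 2) : ℕ) : ℤ) ((Nat.gcd m (y ^ 2) : ℕ) : ℤ) := by
    rw [Nat.isCoprime_iff_coprime]
    exact Nat.Coprime.of_dvd (Nat.gcd_dvd_right _ _) (Nat.gcd_dvd_right _ _) hc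
  have hd : ((Nat.gcd m ((x * y) ^ 2) : ℕ) : ℤ) ∣ b ↔
      ((Nat.gcd m (x ^ 2) : ℕ) : ℤ) ∣ b ∧ ((Nat.gcd m (y ^ 2) : ℕ) : ℤ) ∣ b := by
    rw [hg]; push_cast
    exact ⟨fun h => ⟨(dvd_mul_right _ _).trans h, (dvd_mul_left _ _).trans h⟩,
      fun h => hgc.mul_dvd h.1 h.2⟩
  simp only [hd, Nat.odd_mul]
  rw [hg, ArithmeticFunction.isMultiplicative_moebius.map_mul_of_coprime h]
  by_cases h1 : Odd x ∧ ((Nat.gcd m (x ^ 2) : ℕ) : ℤ) ∣ b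
  · by_cases h2 : Odd y ∧ ((Nat.gcd m (y ^ 2) : ℕ) : ℤ) ∣ b
    · rw [if_pos ⟨⟨h1.1, h2.1⟩, h1.2, h2.2⟩, if_pos h1, if_pos h2]
      push_cast
      rw [mul_pow, div_mul_div_comm]
      ring
    · rw [if_neg (fun h => h2 ⟨h.1.2, h.2.2⟩), if_neg h2, mul_zero]
  · rw [if_neg (fun h => h1 ⟨h.1.1, h.2.1⟩), if_neg h1, zero_mul]

lemma gg_tsum_prime (m : ℕ) (b : ℤ) {p : ℕ} (hp : p.Prime) :
    ∑' e, gg m b (p ^ e) = 1 + gg m b p := by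
  rw [tsum_eq_sum (s := Finset.range 2)]
  · simp [Finset.sum_range_succ, gg_one]
  · intro e he
    have : 1 < e := by simpa using he
    have h0 : ArithmeticFunction.moebius (p ^ e) = 0 := by
      rw [ArithmeticFunction.moebius_apply_prime_pow hp (by omega), if_neg (by omega)]
    unfold gg
    rw [h0]; simp

def cc (m : ℕ) (b : ℤ) (p : ℕ) : ℝ :=
  if p ∈ m.primeFactors then (if p = 2 then 4 / 3 else
    eOdd b p (m.factorization p) * (1 - ((p : ℝ) ^ 2)⁻¹)⁻¹) else 1

lemma one_sub_ne (p : ℕ) (hp : p.Prime) : (1 - ((p : ℝ) ^ 2)⁻¹) ≠ 0 := by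
  have : (1 : ℝ) < p := by exact_mod_cast hp.one_lt
  have : (1 : ℝ) < (p : ℝ) ^ 2 := one_lt_pow₀ this two_ne_zero
  have := inv_lt_one_of_one_lt₀ this
  linarith

lemma local_factor (m : ℕ) (hm : 0 < m) (h2 : 2 ∣ m) (b : ℤ) {p : ℕ} (hp : p.Prime) :
    1 + gg m b p = (1 - ((p : ℝ) ^ 2)⁻¹) * cc m b p := by
  have hne := one_sub_ne p hp
  have hp0 : (p : ℝ) ≠ 0 := by exact_mod_cast hp.ne_zero
  unfold cc
  by_cases hpm : p ∣ m
  · rw [if_pos (Nat.mem_primeFactors.2 ⟨hp, hpm, hm.ne'⟩)]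
    by_cases hp2 : p = 2
    · subst hp2
      have : ¬ Odd 2 := by decide
      simp [gg, this]; norm_num
    · rw [if_neg hp2, mul_comm (eOdd _ _ _), mul_inv_cancel_left₀ hne]
      have hodd := hp.odd_of_ne_two hp2
      unfold gg
      rw [ArithmeticFunction.moebius_apply_prime hp]
      have hk : 1 ≤ m.factorization p := hp.factorization_pos_of_dvd hm.ne' hpm
      by_cases hk1 : m.factorization p = 1
      · have hg : Nat.gcd m (p ^ 2) = p := by
          have h1 : Nat.gcd m (p ^ 2) ∣ p ^ 2 := Nat.gcd_dvd_right _ _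
          obtain ⟨i, hi, hi'⟩ := (Nat.dvd_prime_pow hp).1 h1
          have h3 : p ∣ Nat.gcd m (p ^ 2) := Nat.dvd_gcd hpm (dvd_pow_self p two_ne_zero)
          interval_cases i
          · rw [hi'] at h3; simp at h3; exact absurd h3 hp.one_lt.ne'
          · simpa using hi'
          · have h4 : p ^ 2 ∣ m := by rw [← hi']; exact Nat.gcd_dvd_left _ _
            have := (hp.pow_dvd_iff_le_factorization hm.ne').1 h4
            omega
        rw [hg, hk1]
        unfold eOdd
        by_cases hb : (p : ℤ) ∣ b
        · simp [hodd, hb]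
          field_simp
          ring
        · simp [hb]
      · have hg : Nat.gcd m (p ^ 2) = p ^ 2 := by
          apply Nat.gcd_eq_right
          rw [hp.pow_dvd_iff_le_factorization hm.ne']; omega
        rw [hg]
        unfold eOdd
        have hk2 : 2 ≤ m.factorization p := by omega
        by_cases hb2 : (p : ℤ) ^ 2 ∣ b
        · have hb : (p : ℤ) ∣ b := (dvd_pow_self _ two_ne_zero).trans hb2
          simp [hodd, hb, hb2, hk1]
          field_simp
          ring
        · simp [hb2, hk2]
  · rw [if_neg (fun h => hpm (Nat.dvd_of_mem_primeFactors h)), mul_one]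
    have hp2 : p ≠ 2 := by rintro rfl; exact hpm h2
    have hg : Nat.gcd m (p ^ 2) = 1 := 
      Nat.Coprime.pow_right 2 ((Nat.Prime.coprime_iff_not_dvd hp).2 hpm).symm
    unfold gg
    rw [hg, if_pos ⟨hp.odd_of_ne_two hp2, by simp⟩, ArithmeticFunction.moebius_apply_prime hp]
    push_cast
    field_simp
    ring

lemma hasProd_zeta : HasProd (fun p : Nat.Primes => 1 - ((p : ℝ) ^ 2)⁻¹) (6 / Real.pi ^ 2) := by
  have h := riemannZeta_eulerProduct_hasProd (s := 2) (by norm_num)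
  rw [riemannZeta_two] at h
  have h2 : HasProd (fun p : Nat.Primes => (1 - ((p : ℝ) ^ 2)⁻¹)⁻¹) (Real.pi ^ 2 / 6) := by
    rw [← Complex.isUniformEmbedding_ofReal.isEmbedding.isInducing.hasProd_iff (g := Complex.ofRealHom)]
    convert h using 2
    · rw [Complex.cpow_neg]
      simp
    · simp
  have hpi : Real.pi ^ 2 / 6 ≠ 0 := by positivity
  have := h2.inv₀ hpi
  simpa using this

lemma tsum_gg (m : ℕ) (hm : 0 < m) (h2 : 2 ∣ m) (b : ℤ) :
    ∑' d, gg m b d = 8 / Real.pi ^ 2 * ∏ p ∈ m.primeFactors.filter (fun p => p ≠ 2),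
                eOdd b p (m.factorization p) * (1 - ((p : ℝ) ^ 2)⁻¹)⁻¹ := by
  have h := EulerProduct.eulerProduct_hasProd (f := gg m b) (gg_one m b)
    (fun h => gg_mul m b h) (gg_summable m b hm) (by simp [gg])
  have hc : HasProd (fun p : Nat.Primes => cc m b p) (∏ p ∈ m.primeFactors.subtype Nat.Prime, cc m b p) := by
    apply hasProd_prod_of_ne_finset_one (f := fun p : Nat.Primes => cc m b p)
    intro p hp
    have : (p : ℕ) ∉ m.primeFactors := fun hh => hp (Finset.mem_subtype.2 hh)
    simp only [cc, if_neg this]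
  have h' := hasProd_zeta.mul hc
  have e : (fun p : Nat.Primes => ∑' e, gg m b ((p : ℕ) ^ e)) =
      fun p : Nat.Primes => (1 - ((p : ℝ) ^ 2)⁻¹) * cc m b p := by
    funext p
    rw [gg_tsum_prime m b p.2, local_factor m hm h2 b p.2]
  rw [e] at h
  rw [h.unique h', Finset.prod_subtype_of_mem (f := cc m b) (fun p hp => Nat.prime_of_mem_primeFactors hp)]
  have h2m : 2 ∈ m.primeFactors := Nat.mem_primeFactors.2 ⟨Nat.prime_two, h2, hm.ne'⟩
  rw [← Finset.mul_prod_erase _ _ h2m, Finset.filter_ne' m.primeFactors 2]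
  have e2 : cc m b 2 = 4 / 3 := by simp only [cc, if_pos h2m, if_true]
  rw [e2]
  have e3 : ∏ p ∈ m.primeFactors.erase 2, cc m b p = ∏ p ∈ m.primeFactors.erase 2, 
      eOdd b p (m.factorization p) * (1 - ((p : ℝ) ^ 2)⁻¹)⁻¹ := by
    apply Finset.prod_congr rfl
    intro p hp
    rw [Finset.mem_erase] at hp
    simp only [cc, if_pos hp.2, if_neg hp.1]
  rw [e3]
  ring

-- PART4
lemma eOdd_sign (a s : ℤ) (hs : s = 1 ∨ s = -1) (p k : ℕ) : eOdd (s * a) p k = eOdd a p k := by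
  rcases hs with rfl | rfl <;> simp [eOdd]

lemma oddSqfree_sign (n s : ℤ) (hs : s = 1 ∨ s = -1) : OddSqfree (s * n) ↔ OddSqfree n := by
  rcases hs with rfl | rfl <;> simp [OddSqfree]

lemma lt_iff_le_ceil (n : ℤ) (X : ℝ) : (n : ℝ) < X ↔ n ≤ ⌈X⌉ - 1 := by
  rw [Int.le_sub_one_iff, Int.lt_ceil]

/-- The number of fundamental discriminants in question, when the residue class at 2 is good. -/
lemma card_good (m : ℕ) (h64 : 2 ^ 6 ∣ m) (a : ℤ)
    (ha : a % 4 = 1 ∨ a % 16 = 8 ∨ a % 16 = 12) (X : ℝ) (s : ℤ) (hs : s = 1 ∨ s = -1) :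
    Nat.card {D : ℤ // IsFund D ∧ 0 < s * D ∧ |(D : ℝ)| < X ∧ (m : ℤ) ∣ D - a} =
      ((Finset.filter (fun x => (m : ℤ) ∣ x - s * a ∧ OddSqfree x)
        (Finset.Ioc 0 (⌈X⌉ - 1))).erase s).card := by
  have hss : s * s = 1 := by rcases hs with rfl | rfl <;> norm_num
  have h64' : (64 : ℤ) ∣ m := by exact_mod_cast h64
  have hiff : ∀ D : ℤ, (IsFund D ∧ 0 < s * D ∧ |(D : ℝ)| < X ∧ (m : ℤ) ∣ D - a) ↔
      s * D ∈ (Finset.filter (fun x => (m : ℤ) ∣ x - s * a ∧ OddSqfree x)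
        (Finset.Ioc 0 (⌈X⌉ - 1))).erase s := by
    intro D
    rw [Finset.mem_erase, Finset.mem_filter, Finset.mem_Ioc, oddSqfree_sign D s hs, ← mul_sub]
    have h1 : (m : ℤ) ∣ s * (D - a) ↔ (m : ℤ) ∣ D - a := by
      rcases hs with rfl | rfl
      · rw [one_mul]
      · rw [neg_one_mul, dvd_neg]
    have h2 : s * D ≠ s ↔ D ≠ 1 := by
      rcases hs with rfl | rfl <;> omega
    have h3 : 0 < s * D → (|(D : ℝ)| < X ↔ s * D ≤ ⌈X⌉ - 1) := by
      intro h
      rw [← lt_iff_le_ceil]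
      have : |(D : ℝ)| = ((s * D : ℤ) : ℝ) := by
        have h' : (0 : ℝ) < ((s * D : ℤ) : ℝ) := by exact_mod_cast h
        rcases hs with rfl | rfl
        · push_cast at h' ⊢; rw [one_mul] at h' ⊢; exact abs_of_pos h'
        · push_cast at h' ⊢; rw [neg_one_mul] at h' ⊢; exact abs_of_neg (by linarith)
      rw [this]
    rw [h1, h2]
    constructor
    · rintro ⟨⟨f1, f2, f3⟩, g1, g2, g3⟩
      exact ⟨f1, ⟨g1, (h3 g1).1 g2⟩, g3, f3⟩
    · rintro ⟨f1, ⟨g1, g2⟩, g3, f3⟩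
      refine ⟨⟨f1, ?_, f3⟩, g1, (h3 g1).2 g2, g3⟩
      have := h64'.trans g3
      omega
  rw [← Nat.card_eq_finsetCard]
  apply Nat.card_congr
  refine ⟨fun D => ⟨s * D.1, (hiff D.1).1 D.2⟩, fun n => ⟨s * n.1, (hiff _).2 ?_⟩, ?_, ?_⟩
  · rw [← mul_assoc, hss, one_mul]; exact n.2
  · intro D; apply Subtype.ext; simp [← mul_assoc, hss]
  · intro D; apply Subtype.ext; simp [← mul_assoc, hss]


/-- Counting quadratic fields with discriminant in an arithmetic progression
(Lemma in Section 5.2), with an absolute implied constant. -/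
theorem quadratic_fields_in_progressions :
    ∃ C : ℝ, ∀ m : ℕ, 2 ^ 6 ∣ m → ∀ a : ℤ, ∀ X : ℝ, 1 ≤ X → ∀ s : ℤ, (s = 1 ∨ s = -1) →
      |((countFields (fun K => Module.finrank ℚ K = 2 ∧ 0 < s * subDisc K ∧
            (|subDisc K| : ℝ) < X ∧ (m : ℤ) ∣ (subDisc K - a)) : ℕ) : ℝ)
          - 8 / (Real.pi ^ 2 * (m : ℝ)) * eTwo a *
              (∏ p ∈ m.primeFactors.filter (fun p => p ≠ 2),
                eOdd a p (m.factorization p) * (1 - ((p : ℝ) ^ 2)⁻¹)⁻¹) * X|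
        ≤ C * Real.sqrt X := by
  refine ⟨5, ?_⟩
  intro m h64 a X hX s hs
  have hsq : 1 ≤ Real.sqrt X := Real.one_le_sqrt.2 hX
  rw [countFields_eq (fun D => 0 < s * D ∧ |(D : ℝ)| < X ∧ (m : ℤ) ∣ (D - a))]
  rcases Nat.eq_zero_or_pos m with rfl | hm
  · have hsub : Subsingleton {D : ℤ // IsFund D ∧ 0 < s * D ∧ |(D : ℝ)| < X ∧ ((0 : ℕ) : ℤ) ∣ (D - a)} := by
      constructor
      rintro ⟨D, -, -, -, h⟩ ⟨E, -, -, -, h'⟩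
      simp only [Nat.cast_zero, zero_dvd_iff] at h h'
      apply Subtype.ext
      change D = E
      omega
    have hc := Finite.card_le_one_iff_subsingleton.2 hsub
    have hc' : (Nat.card {D : ℤ // IsFund D ∧ 0 < s * D ∧ |(D : ℝ)| < X ∧ ((0 : ℕ) : ℤ) ∣ (D - a)} : ℝ) ≤ 1 := by
      exact_mod_cast hc
    simp only [Nat.cast_zero, mul_zero, div_zero, zero_mul, sub_zero] at hc' ⊢
    rw [abs_of_nonneg (Nat.cast_nonneg _)]
    linarith
  by_cases ha : a % 4 = 1 ∨ a % 16 = 8 ∨ a % 16 = 12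
  · have he : eTwo a = 1 := by
      unfold eTwo
      split_ifs <;> first | rfl | (exfalso; tauto)
    have hg := card_good m h64 a ha X s hs
    have hsv := sieve m hm (s * a) X hX
    rw [hg, he]
    have h2 : 2 ∣ m := (by norm_num : 2 ∣ 2 ^ 6).trans h64
    rw [tsum_gg m hm h2] at hsv
    simp only [eOdd_sign a s hs] at hsv
    set U := Finset.filter (fun x => (m : ℤ) ∣ x - s * a ∧ OddSqfree x) (Finset.Ioc 0 (⌈X⌉ - 1))
    set P := ∏ p ∈ m.primeFactors.filter (fun p => p ≠ 2),
      eOdd a p (m.factorization p) * (1 - ((p : ℝ) ^ 2)⁻¹)⁻¹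
    have hm' : (m : ℝ) ≠ 0 := by exact_mod_cast hm.ne'
    have e : 8 / (Real.pi ^ 2 * (m : ℝ)) * 1 * P * X = X / m * (8 / Real.pi ^ 2 * P) := by
      field_simp
    rw [e]
    have u1 : ((U.erase s).card : ℝ) ≤ U.card := by exact_mod_cast Finset.card_erase_le
    have u2 : (U.card : ℝ) ≤ (U.erase s).card + 1 := by
      have := Finset.pred_card_le_card_erase (s := U) (a := s)
      exact_mod_cast (by omega : U.card ≤ (U.erase s).card + 1)
    rw [abs_le] at hsv ⊢
    constructor <;> linarith [hsv.1, hsv.2]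
  · have he : eTwo a = 0 := by
      unfold eTwo
      split_ifs <;> first | rfl | (exfalso; tauto)
    have hemp : IsEmpty {D : ℤ // IsFund D ∧ 0 < s * D ∧ |(D : ℝ)| < X ∧ (m : ℤ) ∣ (D - a)} := by
      constructor
      rintro ⟨D, ⟨-, h, -⟩, -, -, h'⟩
      have h64' : (64 : ℤ) ∣ D - a := by
        refine Dvd.dvd.trans ?_ h'
        exact_mod_cast h64
      omega
    rw [he, Nat.card_of_isEmpty]
    simp only [mul_zero, zero_mul, Nat.cast_zero, sub_zero, abs_zero]
    positivity
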